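/- For every integer n ≥ 1 and every p ∈ Fin (2n+1), the least j ∈ Fin (2n+1) maximizing the function j ↦ cos(2π((⌊(p:ℕ)/2⌋ : ℝ) − (⌊(j:ℕ)/2⌋ : ℝ))/(n+1)) (where ⌊·/2⌋ denotes integer division by 2) is j = 2·⌊(p:ℕ)/2⌋; that is, the maximum value 1 is attained exactly at the positions j with ⌊j/2⌋ = ⌊p/2⌋, the leftmost of which is the even position 2·⌊p/2⌋. -/

import Mathlib

/-- The first-layer attention scores in the 2-layer construction of Theorem 10: position
`p` queries position `j` with score `cos (2π(⌊p/2⌋ − ⌊j/2⌋)/(n+1))`. -/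
noncomputable def layer1Score (n : ℕ) (p j : Fin (2 * n + 1)) : ℝ :=
  Real.cos (2 * Real.pi * ((((p : ℕ) / 2 : ℕ) : ℝ) - (((j : ℕ) / 2 : ℕ) : ℝ)) / (n + 1))

/-- Distinct residues below `m` give distinct points of the regular `m`-gon. -/
theorem cos_two_pi_mul_sub_div_eq_one_iff {m a b : ℕ} (ha : a < m) (hb : b < m) :
    Real.cos (2 * Real.pi * ((a : ℝ) - (b : ℝ)) / m) = 1 ↔ b = a := by
  refine ⟨fun h => ?_, fun h => by simp [h]⟩
  obtain ⟨k, hk⟩ := (Real.cos_eq_one_iff _).1 h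
  have hm : (m : ℝ) ≠ 0 := by exact_mod_cast (by omega : m ≠ 0)
  have hpi := Real.pi_ne_zero
  have hreal : (a : ℝ) - b = m * k := by
    field_simp at hk
    linarith
  have hint : (a : ℤ) - b = m * k := by exact_mod_cast hreal
  have hzero : (a : ℤ) - b = 0 :=
    Int.eq_zero_of_abs_lt_dvd ⟨k, hint⟩ (by rw [abs_lt]; omega)
  omega

/-- For every `n ≥ 1` and every `p ∈ Fin (2n+1)`, the least
`j ∈ Fin (2n+1)` maximizing `j ↦ cos (2π(⌊p/2⌋ − ⌊j/2⌋)/(n+1))` is `j = 2·⌊p/2⌋`;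
the maximum value `1` is attained exactly at the positions `j` with `⌊j/2⌋ = ⌊p/2⌋`,
the leftmost of which is the even position `2·⌊p/2⌋`. -/
theorem layer1_attends_to_even_position (n : ℕ) (hn : 1 ≤ n) (p : Fin (2 * n + 1)) :
    (∀ j : Fin (2 * n + 1), layer1Score n p j = 1 ↔ (j : ℕ) / 2 = (p : ℕ) / 2)
    ∧ IsLeast {j : Fin (2 * n + 1) | ∀ j' : Fin (2 * n + 1), layer1Score n p j' ≤ layer1Score n p j}
        (⟨2 * ((p : ℕ) / 2), by have := p.isLt; omega⟩ : Fin (2 * n + 1)) := by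
  have hone : ∀ j : Fin (2 * n + 1), layer1Score n p j = 1 ↔ (j : ℕ) / 2 = (p : ℕ) / 2 := by
    intro j
    have h := cos_two_pi_mul_sub_div_eq_one_iff (m := n + 1) (a := (p : ℕ) / 2)
      (b := (j : ℕ) / 2) (by omega) (by omega)
    rwa [Nat.cast_add_one] at h
  have heven : layer1Score n p ⟨2 * ((p : ℕ) / 2), by omega⟩ = 1 := (hone _).2 (by simp)
  refine ⟨hone, fun j' => heven ▸ Real.cos_le_one _, fun j hj => ?_⟩
  have hj_one : layer1Score n p j = 1 :=
    le_antisymm (Real.cos_le_one _) (heven ▸ hj ⟨2 * ((p : ℕ) / 2), by omega⟩)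
  have := (hone j).1 hj_one
  rw [Fin.le_def]
  dsimp only
  omega
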